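/- arXiv:quant-ph/9703016 — 4 statements merged into one kernel-verified Lean document; each statement's English description precedes it below -/
import Mathlib

section
/- (Theorem 4) Let c : Fin K → H be an orthonormal family with K ≥ 1 spanning a code C, and U a unitary 2^N × 2^N matrix such that U C is orthogonal to C (⟪cᵢ, U cⱼ⟫ = 0 for all i, j). Then an operator E lies in the erasure space of the union code C ⊕ U C (with respect to the concatenated basis c₁,…,c_K, U c₁,…, U c_K) if and only if all of the following hold: (i) E ∈ 𝓔(C); (ii) Uᴴ E U ∈ 𝓔(C); (iii) E·U ∈ 𝓔_pure(C); (iv) Uᴴ·E ∈ 𝓔_pure(C); (v) ⟪c₁, E c₁⟫ = ⟪c₁, Uᴴ E U c₁⟫ (i.e. E ∈ 𝓜(c₁, U)). Equivalently, 𝓔(C ⊕ U C) = 𝓔(C) ∩ U 𝓔(C) Uᴴ ∩ 𝓔_pure(C) Uᴴ ∩ U 𝓔_pure(C) ∩ 𝓜(c₁, U). -/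
open scoped ComplexInnerProductSpace
open Matrix

/-- The action of a matrix on the Hilbert space `EuclideanSpace ℂ (Fin n)`. -/
noncomputable def matApp {n : ℕ} (E : Matrix (Fin n) (Fin n) ℂ)
    (v : EuclideanSpace ℂ (Fin n)) : EuclideanSpace ℂ (Fin n) :=
  Matrix.toEuclideanLin E v

/-- The erasure space `𝓔(C)` of the quantum code with basis `c`:
operators `E` with `⟪cᵢ, E cⱼ⟫ = 0` for `i ≠ j` and all diagonal entries
`⟪cᵢ, E cᵢ⟫` equal. -/
def erasureSpace {n K : ℕ} (c : Fin K → EuclideanSpace ℂ (Fin n)) :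
    Set (Matrix (Fin n) (Fin n) ℂ) :=
  {E | (∀ i j, i ≠ j → ⟪c i, matApp E (c j)⟫ = 0) ∧
       ∀ i j, ⟪c i, matApp E (c i)⟫ = ⟪c j, matApp E (c j)⟫}

/-- The pure erasure space `𝓔_pure(C)` of the quantum code with basis `c`:
operators `E` with `⟪cᵢ, E cⱼ⟫ = 0` for all `i, j`. -/
def pureErasureSpace {n K : ℕ} (c : Fin K → EuclideanSpace ℂ (Fin n)) :
    Set (Matrix (Fin n) (Fin n) ℂ) :=
  {E | ∀ i j, ⟪c i, matApp E (c j)⟫ = 0}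

theorem matApp_mul_aux {n : ℕ} (A B : Matrix (Fin n) (Fin n) ℂ)
    (v : EuclideanSpace ℂ (Fin n)) : matApp (A * B) v = matApp A (matApp B v) := by
  simp [matApp, Matrix.toLpLin_apply, Matrix.mulVec_mulVec]

theorem inner_matApp_conjTranspose_aux {n : ℕ} (A : Matrix (Fin n) (Fin n) ℂ)
    (v w : EuclideanSpace ℂ (Fin n)) : ⟪v, matApp Aᴴ w⟫ = ⟪matApp A v, w⟫ := by
  unfold matApp
  rw [Matrix.toEuclideanLin_conjTranspose_eq_adjoint, LinearMap.adjoint_inner_right]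

/-- Theorem 4: `E` is in the erasure space of the union code `C ⊕ U C` iff
`E ∈ 𝓔(C)`, `Uᴴ E U ∈ 𝓔(C)` (i.e. `E ∈ U 𝓔(C) Uᴴ`), `E U ∈ 𝓔_pure(C)`
(i.e. `E ∈ 𝓔_pure(C) Uᴴ`), `Uᴴ E ∈ 𝓔_pure(C)` (i.e. `E ∈ U 𝓔_pure(C)`), and
`⟪c₁, E c₁⟫ = ⟪c₁, Uᴴ E U c₁⟫` (i.e. `E ∈ 𝓜(c₁, U)`). That is,
`𝓔(C ⊕ U C) = 𝓔(C) ∩ U 𝓔(C) Uᴴ ∩ 𝓔_pure(C) Uᴴ ∩ U 𝓔_pure(C) ∩ 𝓜(c₁, U)`. -/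
theorem mem_erasureSpace_union_unitary_iff {N K : ℕ} (hK : 0 < K)
    (c : Fin K → EuclideanSpace ℂ (Fin (2 ^ N))) (hc : Orthonormal ℂ c)
    (U : Matrix (Fin (2 ^ N)) (Fin (2 ^ N)) ℂ)
    (hU : U ∈ Matrix.unitaryGroup (Fin (2 ^ N)) ℂ)
    (horth : ∀ i j, ⟪c i, matApp U (c j)⟫ = 0)
    (E : Matrix (Fin (2 ^ N)) (Fin (2 ^ N)) ℂ) :
    E ∈ erasureSpace (Fin.append c (fun i => matApp U (c i))) ↔
      E ∈ erasureSpace c ∧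
      Uᴴ * E * U ∈ erasureSpace c ∧
      E * U ∈ pureErasureSpace c ∧
      Uᴴ * E ∈ pureErasureSpace c ∧
      ⟪c ⟨0, hK⟩, matApp E (c ⟨0, hK⟩)⟫ =
        ⟪c ⟨0, hK⟩, matApp (Uᴴ * E * U) (c ⟨0, hK⟩)⟫ := by
  simp only [erasureSpace, pureErasureSpace, Set.mem_ofPred_eq, Matrix.mul_assoc,
    matApp_mul_aux, inner_matApp_conjTranspose_aux]
  constructor
  · rintro ⟨h1, h2⟩
    refine ⟨⟨fun i j hij => ?_, fun i j => ?_⟩, ⟨fun i j hij => ?_, fun i j => ?_⟩,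
      fun i j => ?_, fun i j => ?_, ?_⟩
    · simpa only [Fin.append_left, Fin.append_right] using h1 (Fin.castAdd K i) (Fin.castAdd K j) (by simpa using hij)
    · simpa only [Fin.append_left, Fin.append_right] using h2 (Fin.castAdd K i) (Fin.castAdd K j)
    · simpa only [Fin.append_left, Fin.append_right] using h1 (Fin.natAdd K i) (Fin.natAdd K j) (by simpa using hij)
    · simpa only [Fin.append_left, Fin.append_right] using h2 (Fin.natAdd K i) (Fin.natAdd K j)
    · simpa only [Fin.append_left, Fin.append_right] using h1 (Fin.castAdd K i) (Fin.natAdd K j)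
        (by intro h; have := congrArg Fin.val h; simp at this; omega)
    · simpa only [Fin.append_left, Fin.append_right] using h1 (Fin.natAdd K i) (Fin.castAdd K j)
        (by intro h; have := congrArg Fin.val h; simp at this; omega)
    · simpa only [Fin.append_left, Fin.append_right] using
        h2 (Fin.castAdd K ⟨0, hK⟩) (Fin.natAdd K ⟨0, hK⟩)
  · rintro ⟨⟨a1, a2⟩, ⟨b1, b2⟩, p, q, m⟩
    have key : ∀ i j, ⟪c i, matApp E (c i)⟫ = ⟪matApp U (c j), matApp E (matApp U (c j))⟫ :=
      fun i j => (a2 i ⟨0, hK⟩).trans (m.trans (b2 ⟨0, hK⟩ j))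
    constructor
    · intro i j
      refine Fin.addCases (fun i => ?_) (fun i => ?_) i <;>
      refine Fin.addCases (fun j => ?_) (fun j => ?_) j <;> intro hij <;>
      simp only [Fin.append_left, Fin.append_right]
      · exact a1 i j (fun h => hij (by rw [h]))
      · exact p i j
      · exact q i j
      · exact b1 i j (fun h => hij (by rw [h]))
    · intro i j
      refine Fin.addCases (fun i => ?_) (fun i => ?_) i <;>
      refine Fin.addCases (fun j => ?_) (fun j => ?_) j <;>
      simp only [Fin.append_left, Fin.append_right]
      · exact a2 i j
      · exact key i j
      · exact (key j i).symm
      · exact b2 i j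
end

section
/- Let c ∈ ℂ^(2^5) be the (unnormalized) five-qubit state c = |00000⟩ − (|00011⟩+|00110⟩+|01100⟩+|11000⟩+|10001⟩) + (|00101⟩+|01010⟩+|10100⟩+|01001⟩+|10010⟩) − (|01111⟩+|11110⟩+|11101⟩+|11011⟩+|10111⟩), let τ = 𝟙⊗𝟙⊗σx⊗σx⊗σx (Kronecker product) and let π be the linear map on ℂ^(2^5) induced by the cyclic shift of the five qubits. Then the six vectors c, πτc, π²τc, π³τc, π⁴τc, τc are pairwise orthogonal (and each has the same norm as c). -/
open scoped ComplexInnerProductSpace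
open Matrix Complex

/-- The Pauli matrix σx. -/
def σx : Matrix (Fin 2) (Fin 2) ℂ := !![0, 1; 1, 0]
/-- The Pauli matrix σy. -/
def σy : Matrix (Fin 2) (Fin 2) ℂ := !![0, -I; I, 0]
/-- The Pauli matrix σz. -/
def σz : Matrix (Fin 2) (Fin 2) ℂ := !![1, 0; 0, -1]

/-- The `k`-th bit (big-endian, `k = 0, …, 4`) of an index `i : Fin 32`,
identifying `i` with the five-qubit computational basis state `|b₁b₂b₃b₄b₅⟩`
via `i = 16·b₁ + 8·b₂ + 4·b₃ + 2·b₄ + b₅`. -/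
def bit5 (k : ℕ) (i : Fin 32) : Fin 2 :=
  ⟨i.val / 2 ^ (4 - k) % 2, Nat.mod_lt _ (by norm_num)⟩

/-- The Kronecker product `A₁ ⊗ A₂ ⊗ A₃ ⊗ A₄ ⊗ A₅` of five `2 × 2` matrices,
written as a `32 × 32` matrix under the big-endian identification
`Fin 32 ≃ (Fin 2)⁵`. -/
def kron5 (A₁ A₂ A₃ A₄ A₅ : Matrix (Fin 2) (Fin 2) ℂ) :
    Matrix (Fin 32) (Fin 32) ℂ :=
  Matrix.of fun i j =>
    A₁ (bit5 0 i) (bit5 0 j) * A₂ (bit5 1 i) (bit5 1 j) *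
    A₃ (bit5 2 i) (bit5 2 j) * A₄ (bit5 3 i) (bit5 3 j) *
    A₅ (bit5 4 i) (bit5 4 j)

/-- The five-qubit computational basis state `|b₁b₂b₃b₄b₅⟩`. -/
noncomputable def ket5 (b₁ b₂ b₃ b₄ b₅ : Fin 2) : EuclideanSpace ℂ (Fin 32) :=
  EuclideanSpace.single
    ⟨16 * b₁.val + 8 * b₂.val + 4 * b₃.val + 2 * b₄.val + b₅.val, by
      have h₁ := b₁.isLt; have h₂ := b₂.isLt; have h₃ := b₃.isLt
      have h₄ := b₄.isLt; have h₅ := b₅.isLt; omega⟩ 1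

/-- The (unnormalized) five-qubit state `c` of Rains et al:
`|00000⟩ − (|00011⟩)_cyc + (|00101⟩)_cyc − (|01111⟩)_cyc`. -/
noncomputable def cRains : EuclideanSpace ℂ (Fin 32) :=
  ket5 0 0 0 0 0
    - (ket5 0 0 0 1 1 + ket5 0 0 1 1 0 + ket5 0 1 1 0 0 +
       ket5 1 1 0 0 0 + ket5 1 0 0 0 1)
    + (ket5 0 0 1 0 1 + ket5 0 1 0 1 0 + ket5 1 0 1 0 0 +
       ket5 0 1 0 0 1 + ket5 1 0 0 1 0)
    - (ket5 0 1 1 1 1 + ket5 1 1 1 1 0 + ket5 1 1 1 0 1 +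
       ket5 1 1 0 1 1 + ket5 1 0 1 1 1)

/-- The transformation `τ = 𝟙 ⊗ 𝟙 ⊗ σx ⊗ σx ⊗ σx`. -/
def τ₅ : Matrix (Fin 32) (Fin 32) ℂ := kron5 1 1 σx σx σx

/-- The cyclic shift `π` of the five qubits, as a `32 × 32` matrix:
it permutes the computational basis states `|b₁b₂b₃b₄b₅⟩ ↦ |b₅b₁b₂b₃b₄⟩`. -/
def cyc : Matrix (Fin 32) (Fin 32) ℂ :=
  Matrix.of fun i j =>
    if bit5 0 i = bit5 4 j ∧ bit5 1 i = bit5 0 j ∧ bit5 2 i = bit5 1 j ∧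
       bit5 3 i = bit5 2 j ∧ bit5 4 i = bit5 3 j then 1 else 0

/-- Integer coordinates of `c`. -/
def cZ (i : Fin 32) : ℤ :=
  if i.val = 0 ∨ i.val = 5 ∨ i.val = 10 ∨ i.val = 20 ∨ i.val = 9 ∨ i.val = 18 then 1
  else if i.val = 3 ∨ i.val = 6 ∨ i.val = 12 ∨ i.val = 24 ∨ i.val = 17 ∨
    i.val = 15 ∨ i.val = 30 ∨ i.val = 29 ∨ i.val = 27 ∨ i.val = 23 then -1 else 0

/-- Index map of `τ` (flip of the last three bits). -/
def tauIdx (i : Fin 32) : Fin 32 := ⟨8 * (i.val / 8) + (7 - i.val % 8), by omega⟩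

/-- Index map of the cyclic shift: `(π v) i = v (cycIdx i)`. -/
def cycIdx (i : Fin 32) : Fin 32 := ⟨(2 * i.val) % 32 + i.val / 16, by omega⟩

/-- Integer coordinates of the six vectors. -/
def wZ (k : Fin 6) (i : Fin 32) : ℤ :=
  if k = 0 then cZ i else if k = 5 then cZ (tauIdx i) else cZ (tauIdx (cycIdx^[k.val] i))

lemma matApp_mul' (A B : Matrix (Fin 32) (Fin 32) ℂ) (v : EuclideanSpace ℂ (Fin 32)) :
    matApp (A * B) v = matApp A (matApp B v) := by
  ext i
  simp [matApp, Matrix.toLpLin_apply, Matrix.mulVec_mulVec]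

lemma matApp_idx (A : Matrix (Fin 32) (Fin 32) ℂ) (f : Fin 32 → Fin 32)
    (h : ∀ i j, A i j = if j = f i then 1 else 0) (v : EuclideanSpace ℂ (Fin 32)) (i : Fin 32) :
    matApp A v i = v (f i) := by
  simp [matApp, Matrix.toLpLin_apply, Matrix.mulVec, dotProduct, h]

lemma cyc_entry (i j : Fin 32) : cyc i j = if j = cycIdx i then 1 else 0 := by
  have h : ∀ i j : Fin 32, (bit5 0 i = bit5 4 j ∧ bit5 1 i = bit5 0 j ∧ bit5 2 i = bit5 1 j ∧
       bit5 3 i = bit5 2 j ∧ bit5 4 i = bit5 3 j) ↔ j = cycIdx i := by decide +kernel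
  simp only [cyc, Matrix.of_apply, h]

lemma σx_entry (a b : Fin 2) : σx a b = ((if a = b then 0 else 1 : ℤ) : ℂ) := by
  fin_cases a <;> fin_cases b <;> simp [σx]

lemma one_entry (a b : Fin 2) :
    (1 : Matrix (Fin 2) (Fin 2) ℂ) a b = ((if a = b then 1 else 0 : ℤ) : ℂ) := by
  simp [Matrix.one_apply]

lemma tau_entry (i j : Fin 32) : τ₅ i j = if j = tauIdx i then 1 else 0 := by
  have h : ∀ i j : Fin 32, (if bit5 0 i = bit5 0 j then 1 else 0 : ℤ) *
      (if bit5 1 i = bit5 1 j then 1 else 0) * (if bit5 2 i = bit5 2 j then 0 else 1) *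
      (if bit5 3 i = bit5 3 j then 0 else 1) * (if bit5 4 i = bit5 4 j then 0 else 1) =
      if j = tauIdx i then 1 else 0 := by decide +kernel
  simp only [τ₅, kron5, Matrix.of_apply, σx_entry, one_entry]
  rw [← Int.cast_mul, ← Int.cast_mul, ← Int.cast_mul, ← Int.cast_mul, h]
  push_cast
  rfl

lemma cRains_entry (i : Fin 32) : cRains i = (cZ i : ℂ) := by
  fin_cases i <;> simp [cRains, ket5, cZ, Fin.ext_iff]

lemma cyc_pow_app (k : ℕ) (v : EuclideanSpace ℂ (Fin 32)) (i : Fin 32) :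
    matApp (cyc ^ k) v i = v (cycIdx^[k] i) := by
  induction k generalizing i with
  | zero => simp [matApp, Matrix.toLpLin_apply]
  | succ n ih =>
    rw [pow_succ', matApp_mul', matApp_idx _ _ cyc_entry, ih, Function.iterate_succ_apply]

lemma cyc_tau_app (k : ℕ) (i : Fin 32) :
    matApp (cyc ^ k * τ₅) cRains i = (cZ (tauIdx (cycIdx^[k] i)) : ℂ) := by
  rw [matApp_mul', cyc_pow_app, matApp_idx _ _ tau_entry, cRains_entry]

lemma inner_cast (x y : EuclideanSpace ℂ (Fin 32)) (a b : Fin 32 → ℤ)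
    (hx : ∀ i, x i = (a i : ℂ)) (hy : ∀ i, y i = (b i : ℂ)) :
    ⟪x, y⟫ = ((∑ i, b i * a i : ℤ) : ℂ) := by
  simp [PiLp.inner_apply, hx, hy]

/-- The six vectors `c, πτc, π²τc, π³τc, π⁴τc, τc` are pairwise orthogonal,
and each has the same norm as `c`. -/
theorem rains_six_vectors_orthogonal :
    let v : Fin 6 → EuclideanSpace ℂ (Fin 32) :=
      ![cRains, matApp (cyc * τ₅) cRains, matApp (cyc ^ 2 * τ₅) cRains,
        matApp (cyc ^ 3 * τ₅) cRains, matApp (cyc ^ 4 * τ₅) cRains,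
        matApp τ₅ cRains]
    (∀ i j : Fin 6, i ≠ j → ⟪v i, v j⟫ = 0) ∧
    ∀ i : Fin 6, ‖v i‖ = ‖cRains‖ := by
  intro v
  have hv : ∀ k i, v k i = (wZ k i : ℂ) := by
    intro k i
    fin_cases k
    · exact cRains_entry i
    · have := cyc_tau_app 1 i
      rw [pow_one] at this
      exact this
    · exact cyc_tau_app 2 i
    · exact cyc_tau_app 3 i
    · exact cyc_tau_app 4 i
    · exact (matApp_idx _ _ tau_entry _ i).trans (cRains_entry _)
  have ho : ∀ k l : Fin 6, k ≠ l → ∑ i, wZ l i * wZ k i = 0 := by decide +kernel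
  have hn : ∀ k : Fin 6, ∑ i, wZ k i * wZ k i = 16 := by decide +kernel
  have hs : ∀ k, ‖v k‖ ^ 2 = 16 := by
    intro k
    have h := inner_cast (v k) (v k) _ _ (hv k) (hv k)
    rw [hn, inner_self_eq_norm_sq_to_K] at h
    have h2 : ((‖v k‖ ^ 2 : ℝ) : ℂ) = ((16 : ℝ) : ℂ) := by
      push_cast
      simpa using h
    exact Complex.ofReal_injective h2
  refine ⟨fun k l hkl => ?_, fun k => ?_⟩
  · rw [inner_cast _ _ _ _ (hv k) (hv l), ho k l hkl, Int.cast_zero]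
  · have h0 : ‖cRains‖ ^ 2 = 16 := hs 0
    exact (sq_eq_sq₀ (norm_nonneg _) (norm_nonneg _)).1 ((hs k).trans h0.symm)
end

section
/- Let c ∈ ℂ^(2^5) be the (unnormalized) five-qubit state c = |00000⟩ − (|00011⟩+|00110⟩+|01100⟩+|11000⟩+|10001⟩) + (|00101⟩+|01010⟩+|10100⟩+|01001⟩+|10010⟩) − (|01111⟩+|11110⟩+|11101⟩+|11011⟩+|10111⟩). Then for every five-qubit Pauli error operator E = σ_{i₁}⊗σ_{i₂}⊗σ_{i₃}⊗σ_{i₄}⊗σ_{i₅} whose weight (number of non-identity tensor factors) is 1 or 2, one has ⟪c, E c⟫ = 0; i.e. all error operators of weight one and two lie in the pure erasure space of the one-dimensional code spanned by c. -/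
open scoped ComplexInnerProductSpace
open Matrix Complex

/-- Integer coefficients of the state. -/
def cInt (i : Fin 32) : ℤ :=
  match i.val with
  | 0 => 1
  | 3 => -1 | 6 => -1 | 12 => -1 | 24 => -1 | 17 => -1
  | 5 => 1 | 10 => 1 | 20 => 1 | 9 => 1 | 18 => 1
  | 15 => -1 | 30 => -1 | 29 => -1 | 27 => -1 | 23 => -1
  | _ => 0

/-- Real integer part of the Pauli matrices (`σy = I * pInt 2`). -/
def pInt (a : Fin 4) (i j : Fin 2) : ℤ :=
  match a.val, i.val, j.val with
  | 0, 0, 0 => 1 | 0, 1, 1 => 1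
  | 1, 0, 1 => 1 | 1, 1, 0 => 1
  | 2, 0, 1 => -1 | 2, 1, 0 => 1
  | 3, 0, 0 => 1 | 3, 1, 1 => -1
  | _, _, _ => 0

/-- Phase of the Pauli matrices. -/
noncomputable def pPhase (a : Fin 4) : ℂ := if a = 2 then I else 1

/-- Integer Kronecker entry. -/
def kInt (a b c d e : Fin 4) (i j : Fin 32) : ℤ :=
  pInt a (bit5 0 i) (bit5 0 j) * pInt b (bit5 1 i) (bit5 1 j) *
  pInt c (bit5 2 i) (bit5 2 j) * pInt d (bit5 3 i) (bit5 3 j) *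
  pInt e (bit5 4 i) (bit5 4 j)

/-- Weight contribution. -/
def wt (a : Fin 4) : ℕ := if a = 0 then 0 else 1

theorem cRains_apply (i : Fin 32) : cRains i = (cInt i : ℂ) := by
  fin_cases i <;> simp [cRains, ket5, cInt, Fin.ext_iff]

/-- Integer product that does not evaluate its second factor when the first one vanishes. -/
def lmul (x y : ℤ) : ℤ :=
  match x with
  | Int.ofNat 0 => 0
  | Int.ofNat (n + 1) => Int.ofNat (n + 1) * y
  | Int.negSucc n => Int.negSucc n * y

theorem lmul_eq (x y : ℤ) : lmul x y = x * y := by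
  rcases x with (_ | n) | n <;> simp [lmul]

/-- Short-circuiting version of one term of the sum. -/
def termInt (a b c d e : Fin 4) (i j : Fin 32) : ℤ :=
  lmul (cInt j) (lmul (pInt a (bit5 0 i) (bit5 0 j)) (lmul (pInt b (bit5 1 i) (bit5 1 j))
    (lmul (pInt c (bit5 2 i) (bit5 2 j)) (lmul (pInt d (bit5 3 i) (bit5 3 j))
      (pInt e (bit5 4 i) (bit5 4 j))))))

theorem termInt_eq (a b c d e : Fin 4) (i j : Fin 32) :
    termInt a b c d e i j = kInt a b c d e i j * cInt j := by
  simp only [termInt, lmul_eq, kInt]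
  ring

/-- Tail-free summation over the first `n` indices. -/
def sumTo (F : Fin 32 → ℤ) : ℕ → ℤ
  | 0 => 0
  | n + 1 => sumTo F n + F (Fin.ofNat 32 n)

theorem sumTo_eq (F : Fin 32 → ℤ) : sumTo F 32 = ∑ i, F i := by
  have h : ∀ n, sumTo F n = ∑ i ∈ Finset.range n, F (Fin.ofNat 32 i) := by
    intro n
    induction n with
    | zero => rfl
    | succ n ih => rw [Finset.sum_range_succ, ← ih, sumTo]
  rw [h, Finset.sum_range]
  refine Finset.sum_congr rfl fun i _ => ?_
  congr 1
  exact Fin.ofNat_val_eq_self i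

theorem int_check_aux : ∀ a b c d e : Fin 4,
    (wt a + wt b + wt c + wt d + wt e = 1 ∨ wt a + wt b + wt c + wt d + wt e = 2) →
    sumTo (fun i => lmul (cInt i) (sumTo (fun j => termInt a b c d e i j) 32)) 32 = 0 := by
  decide +kernel

theorem int_check (a b c d e : Fin 4)
    (h : wt a + wt b + wt c + wt d + wt e = 1 ∨ wt a + wt b + wt c + wt d + wt e = 2) :
    ∑ i : Fin 32, ∑ j : Fin 32, cInt i * (kInt a b c d e i j * cInt j) = 0 := by
  have := int_check_aux a b c d e h
  simpa only [sumTo_eq, lmul_eq, termInt_eq, Finset.mul_sum] using this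

theorem pauli_code (M : Matrix (Fin 2) (Fin 2) ℂ)
    (h : M = 1 ∨ M = σx ∨ M = σy ∨ M = σz) :
    ∃ a : Fin 4, (∀ i j, M i j = pPhase a * (pInt a i j : ℂ)) ∧ (if M ≠ 1 then 1 else 0) = wt a := by
  by_cases h1 : M = 1
  · subst h1
    refine ⟨0, fun i j => ?_, by simp [wt]⟩
    fin_cases i <;> fin_cases j <;> simp [pPhase, pInt]
  · rcases h with h | h | h | h
    · exact absurd h h1
    · refine ⟨1, fun i j => ?_, by simp [wt, h1]⟩
      subst h
      fin_cases i <;> fin_cases j <;> simp [pPhase, pInt, σx]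
    · refine ⟨2, fun i j => ?_, by simp [wt, h1]⟩
      subst h
      fin_cases i <;> fin_cases j <;> simp [pPhase, pInt, σy]
    · refine ⟨3, fun i j => ?_, by simp [wt, h1]⟩
      subst h
      fin_cases i <;> fin_cases j <;> simp [pPhase, pInt, σz]

/-- Every five-qubit Pauli error operator of weight one or two lies in the
pure erasure space of the one-dimensional code spanned by `c`:
`⟪c, E c⟫ = 0`. -/
theorem rains_weight_le_two_pure
    (f : Fin 5 → Matrix (Fin 2) (Fin 2) ℂ)
    (hf : ∀ k, f k = 1 ∨ f k = σx ∨ f k = σy ∨ f k = σz)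
    (hw : {k : Fin 5 | f k ≠ 1}.ncard = 1 ∨ {k : Fin 5 | f k ≠ 1}.ncard = 2) :
    ⟪cRains, matApp (kron5 (f 0) (f 1) (f 2) (f 3) (f 4)) cRains⟫ = 0 := by
  classical
  choose g hg hgw using fun k => pauli_code (f k) (hf k)
  have hcard : {k : Fin 5 | f k ≠ 1}.ncard
      = wt (g 0) + wt (g 1) + wt (g 2) + wt (g 3) + wt (g 4) := by
    rw [Set.ncard_eq_toFinset_card', Set.toFinset_ofPred, Finset.card_filter,
      Fin.sum_univ_five]
    simp only [← hgw]
  rw [hcard] at hw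
  have key := int_check _ _ _ _ _ hw
  have key' : (∑ i : Fin 32, ∑ j : Fin 32,
      (cInt i : ℂ) * ((kInt (g 0) (g 1) (g 2) (g 3) (g 4) i j : ℂ) * (cInt j : ℂ))) = 0 := by
    exact_mod_cast key
  have hin : ⟪cRains, matApp (kron5 (f 0) (f 1) (f 2) (f 3) (f 4)) cRains⟫
      = ∑ i : Fin 32, ∑ j : Fin 32, (cInt i : ℂ) *
        (kron5 (f 0) (f 1) (f 2) (f 3) (f 4) i j * (cInt j : ℂ)) := by
    rw [PiLp.inner_apply]
    refine Finset.sum_congr rfl fun i _ => ?_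
    rw [← Finset.mul_sum]
    simp [matApp, Matrix.toLpLin_apply, Matrix.mulVec, dotProduct, cRains_apply, mul_comm]
  rw [hin, ← mul_zero (pPhase (g 0) * pPhase (g 1) * pPhase (g 2) * pPhase (g 3) * pPhase (g 4)),
    ← key', Finset.mul_sum]
  refine Finset.sum_congr rfl fun i _ => ?_
  rw [Finset.mul_sum]
  refine Finset.sum_congr rfl fun j _ => ?_
  simp only [kron5, Matrix.of_apply, hg, kInt]
  push_cast
  ring
end

section
/- Let c₀,…,c₇ ∈ ℂ^(2^4) be the eight four-qubit vectors c₀ = (|0000⟩+|1111⟩)/√2, c₁ = (|0110⟩+|1001⟩)/√2, c₂ = (|0101⟩+|1010⟩)/√2, c₃ = (|1100⟩+|0011⟩)/√2, c₄ = (|0001⟩−|1110⟩)/√2, c₅ = (|0010⟩−|1101⟩)/√2, c₆ = (|0100⟩−|1011⟩)/√2, c₇ = (|1000⟩−|0111⟩)/√2. Then c₀,…,c₇ form an orthonormal family, and cᵢ = τ c_{i−4} for i = 4,…,7 up to reindexing, where τ = 𝟙⊗𝟙⊗𝟙⊗σy; in particular the code spanned by c₀,…,c₃ is orthogonal to its image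 under τ. -/
open scoped ComplexInnerProductSpace
open Matrix Complex

/-- The `k`-th bit (big-endian, `k = 0, …, 3`) of an index `i : Fin 16`,
identifying `i` with the four-qubit computational basis state `|b₁b₂b₃b₄⟩`
via `i = 8·b₁ + 4·b₂ + 2·b₃ + b₄`. -/
def bit4 (k : ℕ) (i : Fin 16) : Fin 2 :=
  ⟨i.val / 2 ^ (3 - k) % 2, Nat.mod_lt _ (by norm_num)⟩

/-- The Kronecker product `A₁ ⊗ A₂ ⊗ A₃ ⊗ A₄` of four `2 × 2` matrices,
written as a `16 × 16` matrix under the big-endian identification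
`Fin 16 ≃ (Fin 2)⁴`. -/
def kron4 (A₁ A₂ A₃ A₄ : Matrix (Fin 2) (Fin 2) ℂ) :
    Matrix (Fin 16) (Fin 16) ℂ :=
  Matrix.of fun i j =>
    A₁ (bit4 0 i) (bit4 0 j) * A₂ (bit4 1 i) (bit4 1 j) *
    A₃ (bit4 2 i) (bit4 2 j) * A₄ (bit4 3 i) (bit4 3 j)

/-- The four-qubit computational basis state `|b₁b₂b₃b₄⟩`. -/
noncomputable def ket4 (b₁ b₂ b₃ b₄ : Fin 2) : EuclideanSpace ℂ (Fin 16) :=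
  EuclideanSpace.single
    ⟨8 * b₁.val + 4 * b₂.val + 2 * b₃.val + b₄.val, by
      have h₁ := b₁.isLt; have h₂ := b₂.isLt
      have h₃ := b₃.isLt; have h₄ := b₄.isLt; omega⟩ 1

/-- The orthonormal basis `c₀, …, c₇` of the `((4,8,1))` union code:
`c₀, …, c₃` generate the `((4,4,2))` code of Grassl–Beth–Pellizzari and
`c₄, …, c₇` generate its image under `τ = 𝟙⊗𝟙⊗𝟙⊗σy`. -/
noncomputable def cGBP : Fin 8 → EuclideanSpace ℂ (Fin 16) :=
  ![(Real.sqrt 2 : ℂ)⁻¹ • (ket4 0 0 0 0 + ket4 1 1 1 1),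
    (Real.sqrt 2 : ℂ)⁻¹ • (ket4 0 1 1 0 + ket4 1 0 0 1),
    (Real.sqrt 2 : ℂ)⁻¹ • (ket4 0 1 0 1 + ket4 1 0 1 0),
    (Real.sqrt 2 : ℂ)⁻¹ • (ket4 1 1 0 0 + ket4 0 0 1 1),
    (Real.sqrt 2 : ℂ)⁻¹ • (ket4 0 0 0 1 - ket4 1 1 1 0),
    (Real.sqrt 2 : ℂ)⁻¹ • (ket4 0 0 1 0 - ket4 1 1 0 1),
    (Real.sqrt 2 : ℂ)⁻¹ • (ket4 0 1 0 0 - ket4 1 0 1 1),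
    (Real.sqrt 2 : ℂ)⁻¹ • (ket4 1 0 0 0 - ket4 0 1 1 1)]

/-- The transformation `τ = 𝟙 ⊗ 𝟙 ⊗ 𝟙 ⊗ σy`. -/
def τ₄ : Matrix (Fin 16) (Fin 16) ℂ := kron4 1 1 1 σy

lemma inner_ket4 (a b c d p q r s : Fin 2) :
    ⟪ket4 a b c d, ket4 p q r s⟫ =
      if a = p ∧ b = q ∧ c = r ∧ d = s then (1 : ℂ) else 0 := by
  unfold ket4
  rw [EuclideanSpace.inner_single_left, PiLp.single_apply]
  simp only [map_one, one_mul]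
  refine if_congr ?_ rfl rfl
  simp only [Fin.ext_iff]
  omega

set_option maxHeartbeats 4000000 in
lemma tau_ket4 (a b c d : Fin 2) :
    matApp τ₄ (ket4 a b c d) = (if d = 0 then I else -I) • ket4 a b c (1 - d) := by
  ext i
  have h : (matApp τ₄ (ket4 a b c d)) i = τ₄ i
      ⟨8 * a.val + 4 * b.val + 2 * c.val + d.val, by omega⟩ := by
    simp [matApp, ket4, Matrix.toLpLin_apply]
  rw [h]
  unfold ket4
  rw [PiLp.smul_apply, PiLp.single_apply]
  fin_cases a <;> fin_cases b <;> fin_cases c <;> fin_cases d <;> fin_cases i <;>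
    simp [τ₄, kron4, bit4, σy, Matrix.one_apply]

lemma inv_sqrt_two_mul : ((Real.sqrt 2 : ℂ)⁻¹) * ((Real.sqrt 2 : ℂ)⁻¹) = 2⁻¹ := by
  rw [← mul_inv, ← Complex.ofReal_mul, Real.mul_self_sqrt (by norm_num)]
  norm_num

lemma cGBP_orthonormal : Orthonormal ℂ cGBP := by
  rw [orthonormal_iff_ite]
  intro i j
  fin_cases i <;> fin_cases j <;>
    simp [cGBP, inner_smul_left, inner_smul_right, inner_add_left, inner_add_right,
      inner_sub_left, inner_sub_right, inner_ket4, -mul_eq_mul_left_iff,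
      -inner_self_eq_norm_sq_to_K] <;>
    linear_combination 2 * inv_sqrt_two_mul

lemma matApp_map_add {n : ℕ} (E : Matrix (Fin n) (Fin n) ℂ) (x y : EuclideanSpace ℂ (Fin n)) :
    matApp E (x + y) = matApp E x + matApp E y := map_add _ _ _

lemma matApp_map_smul {n : ℕ} (E : Matrix (Fin n) (Fin n) ℂ) (r : ℂ)
    (x : EuclideanSpace ℂ (Fin n)) : matApp E (r • x) = r • matApp E x := map_smul _ _ _

lemma tau_cGBP (i : Fin 4) : matApp τ₄ (cGBP (Fin.castAdd 4 i)) =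
    (![I, -I, -I, -I] : Fin 4 → ℂ) i • cGBP (Fin.natAdd 4 (Equiv.swap 1 3 i)) := by
  have e0 : (Equiv.swap (1 : Fin 4) 3) 0 = 0 := by decide
  have e1 : (Equiv.swap (1 : Fin 4) 3) 1 = 3 := by decide
  have e2 : (Equiv.swap (1 : Fin 4) 3) 2 = 2 := by decide
  have e3 : (Equiv.swap (1 : Fin 4) 3) 3 = 1 := by decide
  have n0 : Fin.natAdd 4 (0 : Fin 4) = (4 : Fin 8) := rfl
  have n1 : Fin.natAdd 4 (1 : Fin 4) = (5 : Fin 8) := rfl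
  have n2 : Fin.natAdd 4 (2 : Fin 4) = (6 : Fin 8) := rfl
  have n3 : Fin.natAdd 4 (3 : Fin 4) = (7 : Fin 8) := rfl
  have m0 : Fin.castAdd 4 (0 : Fin 4) = (0 : Fin 8) := rfl
  have m1 : Fin.castAdd 4 (1 : Fin 4) = (1 : Fin 8) := rfl
  have m2 : Fin.castAdd 4 (2 : Fin 4) = (2 : Fin 8) := rfl
  have m3 : Fin.castAdd 4 (3 : Fin 4) = (3 : Fin 8) := rfl
  fin_cases i <;>
    simp only [Fin.zero_eta, Fin.mk_one, Fin.reduceFinMk, e0, e1, e2, e3, n0, n1, n2, n3,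
      m0, m1, m2, m3] <;>
    simp [cGBP, matApp_map_add, matApp_map_smul, tau_ket4] <;> module

/-- The eight vectors `c₀, …, c₇` form an orthonormal family; each of
`c₄, …, c₇` is the image under `τ = 𝟙⊗𝟙⊗𝟙⊗σy` of one of `c₀, …, c₃` up to
reindexing (and a phase of modulus one); in particular the code spanned by
`c₀, …, c₃` is orthogonal to its image under `τ`. -/
theorem gbp_union_basis :
    Orthonormal ℂ cGBP ∧
    (∃ (σ : Fin 4 ≃ Fin 4) (μ : Fin 4 → ℂ), (∀ i, ‖μ i‖ = 1) ∧
      ∀ i : Fin 4, cGBP (Fin.natAdd 4 i) =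
        μ i • matApp τ₄ (cGBP (Fin.castAdd 4 (σ i)))) ∧
    (∀ x ∈ Submodule.span ℂ (Set.range fun i : Fin 4 => cGBP (Fin.castAdd 4 i)),
     ∀ y ∈ Submodule.span ℂ (Set.range fun i : Fin 4 => cGBP (Fin.castAdd 4 i)),
       ⟪x, matApp τ₄ y⟫ = 0) := by
  refine ⟨cGBP_orthonormal, ⟨Equiv.swap 1 3, ![-I, I, I, I], ?_, ?_⟩, ?_⟩
  · intro i
    fin_cases i <;> simp
  · intro i
    rw [tau_cGBP, Equiv.swap_apply_self, smul_smul]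
    have h : (![-I, I, I, I] : Fin 4 → ℂ) i *
        (![I, -I, -I, -I] : Fin 4 → ℂ) (Equiv.swap 1 3 i) = 1 := by
      have e0 : (Equiv.swap (1 : Fin 4) 3) 0 = 0 := by decide
      have e1 : (Equiv.swap (1 : Fin 4) 3) 1 = 3 := by decide
      have e2 : (Equiv.swap (1 : Fin 4) 3) 2 = 2 := by decide
      have e3 : (Equiv.swap (1 : Fin 4) 3) 3 = 1 := by decide
      fin_cases i <;>
        simp only [Fin.zero_eta, Fin.mk_one, Fin.reduceFinMk, e0, e1, e2, e3] <;> simp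
    rw [h, one_smul]
  · intro x hx y hy
    induction hx using Submodule.span_induction with
    | zero => exact inner_zero_left _
    | add u v _ _ hu hv => rw [inner_add_left, hu, hv, add_zero]
    | smul r u _ hu => rw [inner_smul_left, hu, mul_zero]
    | mem u hu =>
      obtain ⟨i, rfl⟩ := hu
      induction hy using Submodule.span_induction with
      | zero => simp [matApp]
      | add u v _ _ hu hv => rw [matApp_map_add, inner_add_right, hu, hv, add_zero]
      | smul r u _ hu => rw [matApp_map_smul, inner_smul_right, hu, mul_zero]
      | mem v hv =>
        obtain ⟨j, rfl⟩ := hv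
        dsimp only
        rw [tau_cGBP, inner_smul_right, cGBP_orthonormal.2, mul_zero]
        intro h
        have := congrArg Fin.val h
        simp only [Fin.val_castAdd, Fin.val_natAdd] at this
        omega
end
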